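/- arXiv:2410.01643 — 2 statements merged into one kernel-verified Lean document; each statement's English description precedes it below -/
import Mathlib

section
/- Let Φ : Matrix X (Fin m) ℝ be a KROPE representation, i.e. Φ * Φᵀ = K₁ + γ • ((P * Φ) * (P * Φ)ᵀ), and assume B := Φᵀ * Φ is invertible. Then for every vector ρ : X → ℝ there exists θ⋆ : Fin m → ℝ such that for every initial θ₀ : Fin m → ℝ, the LSPE iterates defined by θ_{t+1} := B⁻¹.mulVec (Φᵀ.mulVec (ρ + γ • P.mulVec (Φ.mulVec θ_t))) converge to θ⋆ (i.e. KROPE representations stabilize least-squares policy evaluation). -/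
open Matrix Filter

/-- The triangular kernel `1 - |a - b| / 2` is positive semidefinite on points of `[-1, 1]`, being
half the length of the intersection of the intervals of radius one around the points. -/
lemma posSemidef_one_sub_abs_sub_div_two {X : Type*} [Finite X] (r : X → ℝ)
    (hr : ∀ x, |r x| ≤ 1) :
    (Matrix.of fun x y => 1 - |r x - r y| / 2).PosSemidef := by
  have h := MeasureTheory.posSemidef_matrix_measure_inter (μ := MeasureTheory.volume)
    (s := fun x => Set.Icc (r x - 1) (r x + 1)) (fun _ => measurableSet_Icc) (fun x => by simp)
  convert h.smul (show (0 : ℝ) ≤ 1 / 2 by norm_num) using 1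
  ext x y
  have hx := abs_le.1 (hr x)
  have hy := abs_le.1 (hr y)
  have hle : max (r x - 1) (r y - 1) ≤ min (r x + 1) (r y + 1) := by
    simp only [max_le_iff, le_min_iff]
    exact ⟨⟨by linarith, by linarith⟩, by linarith, by linarith⟩
  simp only [Matrix.of_apply, Matrix.smul_apply, Set.Icc_inter_Icc, smul_eq_mul,
    Real.volume_real_Icc_of_le hle]
  rcases le_total (r x) (r y) with hxy | hxy
  · rw [abs_of_nonpos (by linarith), min_eq_left (by linarith), max_eq_right (by linarith)]
    ring
  · rw [abs_of_nonneg (by linarith), min_eq_right (by linarith), max_eq_left (by linarith)]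
    ring

/-- A bound on the Euclidean operator norm of `Aᵀ` is a bound on that of `A`. -/
lemma dotProduct_mulVec_self_le_of_transpose {m n : Type*} [Fintype m] [Fintype n]
    {A : Matrix m n ℝ} {c : ℝ} (hc : 0 ≤ c)
    (hA : ∀ v, (Aᵀ *ᵥ v) ⬝ᵥ (Aᵀ *ᵥ v) ≤ c * (v ⬝ᵥ v)) (v : n → ℝ) :
    (A *ᵥ v) ⬝ᵥ (A *ᵥ v) ≤ c * (v ⬝ᵥ v) := by
  have hcs : ((Aᵀ *ᵥ (A *ᵥ v)) ⬝ᵥ v) ^ 2 ≤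
      ((Aᵀ *ᵥ (A *ᵥ v)) ⬝ᵥ (Aᵀ *ᵥ (A *ᵥ v))) * (v ⬝ᵥ v) := by
    simpa only [dotProduct, sq] using
      Finset.sum_mul_sq_le_sq_mul_sq Finset.univ (Aᵀ *ᵥ (A *ᵥ v)) v
  have hadj : (Aᵀ *ᵥ (A *ᵥ v)) ⬝ᵥ v = (A *ᵥ v) ⬝ᵥ (A *ᵥ v) := by
    rw [mulVec_transpose, ← dotProduct_mulVec]
  have hv : 0 ≤ v ⬝ᵥ v := by simpa using dotProduct_star_self_nonneg v
  have hAv : 0 ≤ (A *ᵥ v) ⬝ᵥ (A *ᵥ v) := by simpa using dotProduct_star_self_nonneg (A *ᵥ v)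
  rw [hadj] at hcs
  have hb := mul_le_mul_of_nonneg_right (hA (A *ᵥ v)) hv
  rcases hAv.eq_or_lt with h0 | hpos
  · rw [← h0]
    positivity
  · refine le_of_mul_le_mul_left ?_ hpos
    linarith

/-- Iterates of an affine map whose linear part contracts the Euclidean norm converge to its fixed
point. -/
lemma exists_tendsto_of_affine_contraction {n : Type*} [Fintype n] [DecidableEq n]
    {A : Matrix n n ℝ} {c : ℝ} (hc0 : 0 ≤ c) (hc1 : c < 1)
    (hA : ∀ v, (A *ᵥ v) ⬝ᵥ (A *ᵥ v) ≤ c * (v ⬝ᵥ v)) (b : n → ℝ) :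
    ∃ θstar : n → ℝ, ∀ θ : ℕ → n → ℝ, (∀ t, θ (t + 1) = b + A *ᵥ θ t) →
      Tendsto θ atTop (nhds θstar) := by
  have hunit : IsUnit (1 - A) := by
    rw [← mulVec_injective_iff_isUnit, ← coe_mulVecLin, ← LinearMap.ker_eq_bot,
      LinearMap.ker_eq_bot']
    intro v hv
    rw [mulVecLin_apply, sub_mulVec, one_mulVec, sub_eq_zero] at hv
    have h := hA v
    rw [← hv] at h
    have hnn : 0 ≤ v ⬝ᵥ v := by simpa using dotProduct_star_self_nonneg v
    exact dotProduct_self_eq_zero.1 (by nlinarith)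
  obtain ⟨θstar, hfix⟩ := (mulVec_surjective_iff_isUnit.2 hunit) b
  rw [sub_mulVec, one_mulVec, sub_eq_iff_eq_add] at hfix
  refine ⟨θstar, fun θ hθ => ?_⟩
  have hstep (t : ℕ) : θ (t + 1) - θstar = A *ᵥ (θ t - θstar) := by
    rw [hθ, mulVec_sub]
    nth_rewrite 1 [hfix]
    abel
  have hbound (t : ℕ) : (θ t - θstar) ⬝ᵥ (θ t - θstar) ≤
      c ^ t * ((θ 0 - θstar) ⬝ᵥ (θ 0 - θstar)) := by
    induction t with
    | zero => simp
    | succ t ih =>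
      rw [hstep, pow_succ', mul_assoc]
      exact (hA _).trans (mul_le_mul_of_nonneg_left ih hc0)
  have hlim : Tendsto (fun t => c ^ t * ((θ 0 - θstar) ⬝ᵥ (θ 0 - θstar))) atTop (nhds 0) := by
    simpa using (tendsto_pow_atTop_nhds_zero_of_lt_one hc0 hc1).mul_const _
  rw [tendsto_pi_nhds]
  intro i
  have hsq : Tendsto (fun t => (θ t i - θstar i) ^ 2) atTop (nhds 0) := by
    refine squeeze_zero (fun t => sq_nonneg _) (fun t => le_trans ?_ (hbound t)) hlim
    rw [sq]
    exact Finset.single_le_sum (f := fun j => (θ t - θstar) j * (θ t - θstar) j)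
      (fun j _ => mul_self_nonneg _) (Finset.mem_univ i)
  have habs : Tendsto (fun t => |θ t i - θstar i|) atTop (nhds 0) := by
    simpa [Real.sqrt_sq_eq_abs] using hsq.sqrt
  exact tendsto_sub_nhds_zero_iff.1 ((tendsto_zero_iff_abs_tendsto_zero _).2 habs)

/-- **KROPE representations stabilize LSPE.**
If `Φ` is a KROPE representation, i.e. `Φ * Φᵀ = K₁ + γ • ((P * Φ) * (P * Φ)ᵀ)`,
and `B := Φᵀ * Φ` is invertible, then for every reward vector `ρ` there exists
`θ⋆` such that for every initial `θ₀`, the LSPE iterates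
`θ_{t+1} := B⁻¹ (Φᵀ (ρ + γ • P (Φ θ_t)))` converge to `θ⋆`. -/
theorem krope_stabilizes_lspe
    {X : Type*} [Fintype X] [Nonempty X] [DecidableEq X]
    (γ : ℝ) (hγ0 : 0 ≤ γ) (hγ1 : γ < 1)
    (P : Matrix X X ℝ) (hPnn : ∀ x y, 0 ≤ P x y) (hProw : ∀ x, ∑ y, P x y = 1)
    (r : X → ℝ) (hr : ∀ x, |r x| ≤ 1)
    (K₁ : Matrix X X ℝ) (hK₁ : ∀ x y, K₁ x y = 1 - |r x - r y| / 2)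
    (m : ℕ) (Φ : Matrix X (Fin m) ℝ)
    (hΦ : Φ * Φᵀ = K₁ + γ • ((P * Φ) * (P * Φ)ᵀ))
    (hB : IsUnit (Φᵀ * Φ)) :
    ∀ ρ : X → ℝ, ∃ θstar : Fin m → ℝ,
      ∀ θ : ℕ → (Fin m → ℝ),
        (∀ t, θ (t + 1) =
            (Φᵀ * Φ)⁻¹.mulVec (Φᵀ.mulVec (ρ + γ • P.mulVec (Φ.mulVec (θ t))))) →
        Tendsto θ atTop (nhds θstar) := by
  intro ρ
  have hK : K₁.PosSemidef := by
    convert posSemidef_one_sub_abs_sub_div_two r hr using 1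
    ext x y
    exact hK₁ x y
  set L : Matrix (Fin m) X ℝ := (Φᵀ * Φ)⁻¹ * Φᵀ with hL
  have hLΦ : L * Φ = 1 := by
    rw [hL, Matrix.mul_assoc, nonsing_inv_mul _ ((isUnit_iff_isUnit_det _).1 hB)]
  -- The squared norms of `Φᵀ` and `(P * Φ)ᵀ` differ by the quadratic form of `K₁`.
  have hdom (w : X → ℝ) :
      γ * (((P * Φ)ᵀ *ᵥ w) ⬝ᵥ ((P * Φ)ᵀ *ᵥ w)) ≤ (Φᵀ *ᵥ w) ⬝ᵥ (Φᵀ *ᵥ w) := by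
    have hquad (M : Matrix X (Fin m) ℝ) :
        (Mᵀ *ᵥ w) ⬝ᵥ (Mᵀ *ᵥ w) = w ⬝ᵥ ((M * Mᵀ) *ᵥ w) := by
      rw [← mulVec_mulVec, dotProduct_mulVec w, ← mulVec_transpose]
    have hnn : 0 ≤ w ⬝ᵥ (K₁ *ᵥ w) := by simpa using hK.dotProduct_mulVec_nonneg w
    rw [hquad, hquad, hΦ, add_mulVec, dotProduct_add, smul_mulVec, dotProduct_smul, smul_eq_mul]
    linarith
  have hcontr (v : Fin m → ℝ) :
      ((γ • (L * (P * Φ)))ᵀ *ᵥ v) ⬝ᵥ ((γ • (L * (P * Φ)))ᵀ *ᵥ v) ≤ γ * (v ⬝ᵥ v) := by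
    have h := hdom (Lᵀ *ᵥ v)
    rw [mulVec_mulVec, mulVec_mulVec, ← transpose_mul, ← transpose_mul, hLΦ, transpose_one,
      one_mulVec] at h
    rw [transpose_smul, smul_mulVec, smul_dotProduct, dotProduct_smul, smul_eq_mul, smul_eq_mul]
    exact mul_le_mul_of_nonneg_left h hγ0
  obtain ⟨θstar, hθstar⟩ := exists_tendsto_of_affine_contraction hγ0 hγ1
    (dotProduct_mulVec_self_le_of_transpose hγ0 hcontr) (L *ᵥ ρ)
  refine ⟨θstar, fun θ hθ => hθstar θ fun t => ?_⟩
  rw [hθ, mulVec_mulVec, ← hL, mulVec_add, mulVec_smul, smul_mulVec, mulVec_mulVec, mulVec_mulVec,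
    Matrix.mul_assoc]
end

section
/- Let X be a finite type and r : X → ℝ with |r x| ≤ 1 for all x. Then the short-term similarity matrix K₁ : Matrix X X ℝ defined by K₁ x y = 1 − |r x − r y| / 2 is positive semidefinite. -/
open Matrix

/-- The matrix of pairwise minima of a nonnegative function is positive semidefinite. -/
theorem posSemidef_of_min {X : Type*} [Finite X] {f : X → ℝ} (hf : ∀ x, 0 ≤ f x) :
    (Matrix.of fun x y : X => min (f x) (f y)).PosSemidef := by
  have h := MeasureTheory.posSemidef_matrix_measure_inter (μ := MeasureTheory.volume)
    (s := fun x => Set.Ico 0 (f x)) (fun _ => measurableSet_Ico) (fun _ => by simp)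
  convert h using 1
  ext x y
  simp [Set.Ico_inter_Ico, hf]

/-- **The short-term similarity matrix `K₁` is positive semidefinite.**
If `|r x| ≤ 1` for all `x`, then the matrix with entries
`K₁ x y = 1 − |r x − r y| / 2` is positive semidefinite. -/
theorem k1_posSemidef
    {X : Type*} [Fintype X]
    (r : X → ℝ) (hr : ∀ x, |r x| ≤ 1) :
    (Matrix.of (fun x y : X => 1 - |r x - r y| / 2)).PosSemidef := by
  have hplus : (Matrix.of fun x y : X => min (1 + r x) (1 + r y)).PosSemidef :=
    posSemidef_of_min fun x => by linarith [(abs_le.mp (hr x)).1]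
  have hminus : (Matrix.of fun x y : X => min (1 - r x) (1 - r y)).PosSemidef :=
    posSemidef_of_min fun x => by linarith [(abs_le.mp (hr x)).2]
  convert (hplus.add hminus).smul (show (0 : ℝ) ≤ 1 / 2 by norm_num) using 1
  ext x y
  simp only [Matrix.of_apply, Matrix.smul_apply, Matrix.add_apply, smul_eq_mul]
  rcases le_total (r x) (r y) with h | h
  · rw [min_eq_left (by linarith), min_eq_right (by linarith), abs_of_nonpos (by linarith)]
    ring
  · rw [min_eq_right (by linarith), min_eq_left (by linarith), abs_of_nonneg (by linarith)]
    ring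
end
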